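/- Theorem 1 (connection between uncertainties): Let 𝒴 be a finite label set with |𝒴| ≥ 2, let Y be uniformly distributed over 𝒴, let X be a discrete random variable on a finite set 𝒳 jointly distributed with Y, and let f : 𝒳 → 𝒵 (graph encoder) and h : 𝒵 → 𝒴 (downstream classifier) be functions into a finite set 𝒵. Let φ ∈ ℝ be a predictive-uncertainty value satisfying I(X; f(X)) ≤ −φ and φ < log 2, and suppose Pr[ h(f(X)) ≠ Y ] < 1. Define the conventional (cross-entropy) uncertainty L_CE = −log( 1 − Pr[ h(f(X)) ≠ Y ] ). Then L_CE ≥ log( log|𝒴| / (log 2 − φ) ). -/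

import Mathlib

open Finset

open scoped Classical

/-- Probability of an event `E` under a probability mass function `p` on a finite sample
space `Ω`. -/
noncomputable def pr {Ω : Type*} [Fintype Ω] (p : Ω → ℝ) (E : Ω → Prop) : ℝ :=
  ∑ ω, if E ω then p ω else 0

/-- Mutual information `I(X;Y)` of two discrete random variables (natural logarithm,
with the convention `0 · log 0 = 0`). -/
noncomputable def mutualInfo {Ω 𝒳 𝒴 : Type*} [Fintype Ω] [Fintype 𝒳] [Fintype 𝒴]
    (p : Ω → ℝ) (X : Ω → 𝒳) (Y : Ω → 𝒴) : ℝ :=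
  ∑ x : 𝒳, ∑ y : 𝒴,
    pr p (fun ω => X ω = x ∧ Y ω = y) *
      Real.log (pr p (fun ω => X ω = x ∧ Y ω = y) /
        (pr p (fun ω => X ω = x) * pr p (fun ω => Y ω = y)))

/-- The law of the unconscious statistician on a finite sample space. -/
lemma sum_pr_eq_mul {Ω α : Type*} [Fintype Ω] [Fintype α] (p : Ω → ℝ) (T : Ω → α) (g : α → ℝ) :
    ∑ t, pr p (fun ω => T ω = t) * g t = ∑ ω, p ω * g (T ω) := by
  simp only [pr, Finset.sum_mul]
  rw [Finset.sum_comm]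
  refine Finset.sum_congr rfl fun ω _ => ?_
  simp [ite_mul]

lemma pr_nonneg {Ω : Type*} [Fintype Ω] {p : Ω → ℝ} (hp0 : ∀ ω, 0 ≤ p ω) (E : Ω → Prop) :
    0 ≤ pr p E :=
  Finset.sum_nonneg fun ω _ => by split_ifs <;> simp [hp0 ω]

lemma pr_mono {Ω : Type*} [Fintype Ω] {p : Ω → ℝ} (hp0 : ∀ ω, 0 ≤ p ω) {E F : Ω → Prop}
    (hEF : ∀ ω, E ω → F ω) : pr p E ≤ pr p F := by
  refine Finset.sum_le_sum fun ω _ => ?_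
  by_cases hE : E ω
  · simp [hE, hEF ω hE]
  · by_cases hF : F ω <;> simp [hE, hF, hp0 ω]

lemma one_sub_pr_not {Ω : Type*} [Fintype Ω] {p : Ω → ℝ} (hp1 : ∑ ω, p ω = 1) (E : Ω → Prop) :
    1 - pr p (fun ω => ¬ E ω) = pr p E := by
  rw [← hp1, pr, pr, ← Finset.sum_sub_distrib]
  refine Finset.sum_congr rfl fun ω _ => ?_
  by_cases hE : E ω <;> simp [hE]

lemma sum_pr_and_eq {Ω α : Type*} [Fintype Ω] [Fintype α] (p : Ω → ℝ) (T : Ω → α)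
    (E : α → Ω → Prop) :
    ∑ t, pr p (fun ω => T ω = t ∧ E t ω) = pr p (fun ω => E (T ω) ω) := by
  simp only [pr]
  rw [Finset.sum_comm]
  refine Finset.sum_congr rfl fun ω _ => ?_
  rw [Finset.sum_eq_single (T ω)]
  · simp
  · intro t _ ht
    simp [ht.symm]
  · simp

/-- The mutual information between `X` and a function of `X` is the entropy of that function. -/
lemma mutualInfo_comp_eq_entropy {Ω 𝒳 𝒵 : Type*} [Fintype Ω] [Fintype 𝒳] [Fintype 𝒵]
    (p : Ω → ℝ) (X : Ω → 𝒳) (f : 𝒳 → 𝒵) :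
    mutualInfo p X (fun ω => f (X ω)) =
      ∑ z, pr p (fun ω => f (X ω) = z) * -Real.log (pr p (fun ω => f (X ω) = z)) := by
  have hjoint : ∀ x z, pr p (fun ω => X ω = x ∧ f (X ω) = z) =
      if f x = z then pr p (fun ω => X ω = x) else 0 := by
    intro x z
    unfold pr
    split_ifs with hz
    · refine Finset.sum_congr rfl fun ω _ => ?_
      by_cases hx : X ω = x <;> simp [hx, hz]
    · refine Finset.sum_eq_zero fun ω _ => ?_
      by_cases hx : X ω = x <;> simp [hx, hz]
  have hsum : mutualInfo p X (fun ω => f (X ω)) =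
      ∑ x, pr p (fun ω => X ω = x) * -Real.log (pr p (fun ω => f (X ω) = f x)) := by
    refine Finset.sum_congr rfl fun x _ => ?_
    rw [Finset.sum_eq_single (f x)]
    · rw [hjoint, if_pos rfl]
      by_cases hx : pr p (fun ω => X ω = x) = 0
      · simp [hx]
      · rw [div_mul_cancel_left₀ hx, Real.log_inv]
    · intro z _ hz
      rw [hjoint, if_neg (Ne.symm hz), zero_mul]
    · simp
  rw [hsum, sum_pr_eq_mul p X (fun x => -Real.log (pr p (fun ω => f (X ω) = f x))),
    sum_pr_eq_mul p (fun ω => f (X ω)) (fun z => -Real.log (pr p (fun ω => f (X ω) = z)))]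

lemma mul_log_mul_le_half {a q k : ℝ} (ha : 0 ≤ a) (haq : a ≤ q) (hk : 0 < k) (hak : a ≤ 1 / k) :
    a * Real.log (k * q) ≤ q / 2 := by
  rcases ha.eq_or_lt with rfl | ha
  · linarith [zero_mul (Real.log (k * q))]
  have hq : 0 < q := ha.trans_le haq
  have hle : k * q ≤ 2 * (q / (2 * a)) := by
    have hka : a * k ≤ 1 := (le_div_iff₀ hk).mp hak
    have hdiv : 2 * (q / (2 * a)) = q / a := by field_simp
    rw [hdiv, le_div_iff₀ ha]
    nlinarith
  have hlog : Real.log (k * q) ≤ q / (2 * a) := by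
    have hpos : 0 < q / (2 * a) := by positivity
    have hmono := Real.log_le_log (mul_pos hk hq) hle
    rw [Real.log_mul two_ne_zero hpos.ne'] at hmono
    linarith [Real.log_le_sub_one_of_pos hpos, Real.log_two_lt_d9]
  calc a * Real.log (k * q) ≤ a * (q / (2 * a)) := mul_le_mul_of_nonneg_left hlog ha.le
    _ = q / 2 := by field_simp

/-- If `Y` is uniform on `𝒴`, then guessing `Y` from `Z` succeeds with probability at most
`(H(Z) + log 2) / log |𝒴|`. -/
lemma pr_correct_mul_log_card_le {Ω 𝒴 𝒵 : Type*} [Fintype Ω] [Fintype 𝒴] [Fintype 𝒵]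
    {p : Ω → ℝ} (hp0 : ∀ ω, 0 ≤ p ω) (hp1 : ∑ ω, p ω = 1)
    (Z : Ω → 𝒵) (Y : Ω → 𝒴) (h : 𝒵 → 𝒴) (hcard : 0 < Fintype.card 𝒴)
    (hunif : ∀ y : 𝒴, pr p (fun ω => Y ω = y) = 1 / (Fintype.card 𝒴 : ℝ)) :
    pr p (fun ω => h (Z ω) = Y ω) * Real.log (Fintype.card 𝒴) ≤
      Real.log 2 + ∑ z, pr p (fun ω => Z ω = z) * -Real.log (pr p (fun ω => Z ω = z)) := by
  have hk : (0 : ℝ) < Fintype.card 𝒴 := by exact_mod_cast hcard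
  have hmass : ∑ z, pr p (fun ω => Z ω = z) = 1 := by
    simpa [hp1] using sum_pr_eq_mul p Z (fun _ => 1)
  have hterm : ∀ z, pr p (fun ω => Z ω = z ∧ h z = Y ω) * Real.log (Fintype.card 𝒴) ≤
      pr p (fun ω => Z ω = z) / 2 +
        pr p (fun ω => Z ω = z) * -Real.log (pr p (fun ω => Z ω = z)) := by
    intro z
    have ha : 0 ≤ pr p (fun ω => Z ω = z ∧ h z = Y ω) := pr_nonneg hp0 _
    have haq : pr p (fun ω => Z ω = z ∧ h z = Y ω) ≤ pr p (fun ω => Z ω = z) :=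
      pr_mono hp0 fun _ hω => hω.1
    have hak : pr p (fun ω => Z ω = z ∧ h z = Y ω) ≤ 1 / (Fintype.card 𝒴 : ℝ) :=
      hunif (h z) ▸ pr_mono hp0 fun _ hω => hω.2.symm
    have hq1 : pr p (fun ω => Z ω = z) ≤ 1 :=
      hmass ▸ Finset.single_le_sum (f := fun z => pr p (fun ω => Z ω = z))
        (fun _ _ => pr_nonneg hp0 _) (Finset.mem_univ z)
    have hbound := mul_log_mul_le_half ha haq hk hak
    generalize pr p (fun ω => Z ω = z ∧ h z = Y ω) = a at *
    generalize pr p (fun ω => Z ω = z) = q at *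
    rcases (ha.trans haq).eq_or_lt with rfl | hq
    · simp [le_antisymm haq ha]
    · rw [Real.log_mul hk.ne' hq.ne'] at hbound
      nlinarith [Real.log_nonpos hq.le hq1]
  calc pr p (fun ω => h (Z ω) = Y ω) * Real.log (Fintype.card 𝒴)
      = ∑ z, pr p (fun ω => Z ω = z ∧ h z = Y ω) * Real.log (Fintype.card 𝒴) := by
        rw [← Finset.sum_mul, sum_pr_and_eq p Z (fun z ω => h z = Y ω)]
    _ ≤ ∑ z, (pr p (fun ω => Z ω = z) / 2 +
          pr p (fun ω => Z ω = z) * -Real.log (pr p (fun ω => Z ω = z))) :=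
        Finset.sum_le_sum fun z _ => hterm z
    _ ≤ _ := by
        rw [Finset.sum_add_distrib, ← Finset.sum_div, hmass]
        linarith [Real.log_two_gt_d9]

/-- **Theorem 1 (connection between uncertainties).** If `Y` is uniform over a finite
label set `𝒴` with `|𝒴| ≥ 2`, `f` is a graph encoder, `h` a downstream classifier, and
`φ` is a predictive-uncertainty value with `I(X; f(X)) ≤ −φ` and `φ < log 2`, then the
cross-entropy uncertainty `L_CE = −log(1 − Pr[h(f(X)) ≠ Y])` satisfies
`L_CE ≥ log (log |𝒴| / (log 2 − φ))`. -/
theorem uncertainty_connection {Ω 𝒳 𝒴 𝒵 : Type*}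
    [Fintype Ω] [Fintype 𝒳] [Fintype 𝒴] [Fintype 𝒵]
    (p : Ω → ℝ) (hp0 : ∀ ω, 0 ≤ p ω) (hp1 : ∑ ω, p ω = 1)
    (X : Ω → 𝒳) (Y : Ω → 𝒴) (f : 𝒳 → 𝒵) (h : 𝒵 → 𝒴)
    (hcard : 2 ≤ Fintype.card 𝒴)
    (hunif : ∀ y : 𝒴, pr p (fun ω => Y ω = y) = 1 / (Fintype.card 𝒴 : ℝ))
    (φ : ℝ)
    (hI : mutualInfo p X (fun ω => f (X ω)) ≤ -φ)
    (hφ : φ < Real.log 2)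
    (herr : pr p (fun ω => h (f (X ω)) ≠ Y ω) < 1) :
    -Real.log (1 - pr p (fun ω => h (f (X ω)) ≠ Y ω)) ≥
      Real.log (Real.log (Fintype.card 𝒴) / (Real.log 2 - φ)) := by
  have hcorrect : 1 - pr p (fun ω => h (f (X ω)) ≠ Y ω) = pr p (fun ω => h (f (X ω)) = Y ω) :=
    one_sub_pr_not hp1 _
  have hpos : 0 < pr p (fun ω => h (f (X ω)) = Y ω) := by linarith
  have hK : 0 < Real.log (Fintype.card 𝒴) := Real.log_pos (by exact_mod_cast hcard)
  have hgap : 0 < Real.log 2 - φ := by linarith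
  have hfano := pr_correct_mul_log_card_le hp0 hp1 (fun ω => f (X ω)) Y h (by omega) hunif
  rw [mutualInfo_comp_eq_entropy] at hI
  rw [hcorrect, ge_iff_le, ← Real.log_inv]
  refine Real.log_le_log (div_pos hK hgap) ?_
  rw [div_le_iff₀ hgap, inv_mul_eq_div, le_div_iff₀ hpos]
  linarith
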